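/- (Generalized Hamilton–Cayley theorem.) Let A = (A_1,…,A_q) be a system of endomorphisms of the p-dimensional space V and let T = (T_u(A) : u ∈ ℕ^q) be its generalized Newton transformation. Then for every multi-index u ∈ ℕ^q with |u| ≥ p one has T_u(A) = 0. -/

import Mathlib

open scoped BigOperators

namespace GNTPaper

variable {p q : ℕ}

/-- The Newton polynomial `P_A(t) = det(1_V + tA)` of a system of endomorphisms
(represented as matrices w.r.t. an orthonormal basis), as a multivariate
polynomial in the variables `t_1, …, t_q`. -/
noncomputable def newtonMvPoly (A : Fin q → Matrix (Fin p) (Fin p) ℝ) :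
    MvPolynomial (Fin q) ℝ :=
  Matrix.det (1 + ∑ α : Fin q, (MvPolynomial.X α : MvPolynomial (Fin q) ℝ) •
    (A α).map (fun x => (MvPolynomial.C x : MvPolynomial (Fin q) ℝ)))

/-- `σ_u(A)`: the coefficient of `t^u` in the Newton polynomial `P_A(t) = det(1 + tA)`. -/
noncomputable def sigma (A : Fin q → Matrix (Fin p) (Fin p) ℝ) (u : Fin q → ℕ) : ℝ :=
  MvPolynomial.coeff (Finsupp.equivFunOnFinite.symm u) (newtonMvPoly A)

/-- A matrix `i ∈ I(q,s)` (a `q × s` matrix of zeros and ones with exactly one `1`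
in each column) is encoded by the function `c : Fin s → Fin q` recording, for each
column `l`, the row `c l` containing its unique entry `1`.  `wt c α` is then the
weight `|i^α| = Σ_l i^α_l`, i.e. the number of columns whose `1` lies in row `α`. -/
def wt {s : ℕ} (c : Fin s → Fin q) (α : Fin q) : ℕ :=
  (Finset.univ.filter fun l => c l = α).card

/-- The ordered composition `A^i = A_{c(1)} ⬝ A_{c(2)} ⬝ ⋯ ⬝ A_{c(s)}` associated to a
matrix `i ∈ I(q,s)` encoded by `c : Fin s → Fin q` (`A^i = 1` for `s = 0`). -/
noncomputable def prodSeq (A : Fin q → Matrix (Fin p) (Fin p) ℝ) {s : ℕ}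
    (c : Fin s → Fin q) : Matrix (Fin p) (Fin p) ℝ :=
  (List.ofFn fun l => A (c l)).prod

/-- `σ_{u - |i|}(A)`, where by convention it is `0` whenever `u - |i|` has a
negative entry. -/
noncomputable def sigmaSub (A : Fin q → Matrix (Fin p) (Fin p) ℝ) (u : Fin q → ℕ)
    {s : ℕ} (c : Fin s → Fin q) : ℝ :=
  if ∀ α, wt c α ≤ u α then sigma A (fun α => u α - wt c α) else 0

/-- The generalized Newton transformation
`T_u(A) = Σ_{s=0}^{|u|} Σ_{i ∈ I(q,s)} (-1)^{‖i‖} σ_{u-|i|}(A) A^i`. -/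
noncomputable def gnt (A : Fin q → Matrix (Fin p) (Fin p) ℝ) (u : Fin q → ℕ) :
    Matrix (Fin p) (Fin p) ℝ :=
  ∑ s ∈ Finset.range ((∑ α, u α) + 1),
    (-1 : ℝ) ^ s • ∑ c : Fin s → Fin q, sigmaSub A u c • prodSeq A c

/-- `T_{α♭(u)}(A)`, with the convention that it is `0` when `u α = 0`. -/
noncomputable def gntFlat (A : Fin q → Matrix (Fin p) (Fin p) ℝ) (α : Fin q)
    (u : Fin q → ℕ) : Matrix (Fin p) (Fin p) ℝ :=
  if u α = 0 then 0 else gnt A (Function.update u α (u α - 1))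

/-- `σ_{α♭(u)}(A)`, with the convention that it is `0` when `u α = 0`. -/
noncomputable def sigmaFlat (A : Fin q → Matrix (Fin p) (Fin p) ℝ) (α : Fin q)
    (u : Fin q → ℕ) : ℝ :=
  if u α = 0 then 0 else sigma A (Function.update u α (u α - 1))

/-- The generalized Kronecker symbol `δ^{i_1…i_r}_{j_1…j_r}`, equal to `+1` (resp. `-1`)
if the `i`'s are distinct and the `j`'s are an even (resp. odd) permutation of the `i`'s,
and `0` otherwise; given by the classical determinant formula `det(δ_{i_k j_l})_{k,l}`. -/
noncomputable def gkron {n r : ℕ} (i j : Fin r → Fin n) : ℝ :=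
  Matrix.det (Matrix.of fun k l : Fin r => if i k = j l then (1 : ℝ) else 0)

/-- For `k < 2m`, the index `⌊k/2⌋ < m`; used to pair consecutive indices. -/
def halfIdx {m : ℕ} (k : Fin (2 * m)) : Fin m :=
  ⟨(k : ℕ) / 2, Nat.div_lt_of_lt_mul k.isLt⟩

/-- The scalar `S_r(A)` (for `r = 2m` even) from Reilly's construction. -/
noncomputable def Sr (A : Fin q → Matrix (Fin p) (Fin p) ℝ) (m : ℕ) : ℝ :=
  (1 / ((2 * m).factorial : ℝ)) *
    ∑ iv : Fin (2 * m) → Fin p, ∑ jv : Fin (2 * m) → Fin p,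
      gkron iv jv * ∑ a : Fin m → Fin q, ∏ k : Fin (2 * m), A (a (halfIdx k)) (iv k) (jv k)

/-- The Reilly operator `T_r(A)` (for `r = 2m` even). -/
noncomputable def TrReilly (A : Fin q → Matrix (Fin p) (Fin p) ℝ) (m : ℕ) :
    Matrix (Fin p) (Fin p) ℝ :=
  Matrix.of fun i j => (1 / ((2 * m).factorial : ℝ)) *
    ∑ iv : Fin (2 * m) → Fin p, ∑ jv : Fin (2 * m) → Fin p,
      gkron (Fin.snoc iv i) (Fin.snoc jv j) *
        ∑ a : Fin m → Fin q, ∏ k : Fin (2 * m), A (a (halfIdx k)) (iv k) (jv k)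

/-- The Reilly operator `T_{r+1}^α(A)` (for `r = 2m` even). -/
noncomputable def Tr1Reilly (A : Fin q → Matrix (Fin p) (Fin p) ℝ) (m : ℕ) (α : Fin q) :
    Matrix (Fin p) (Fin p) ℝ :=
  Matrix.of fun i j => (1 / ((2 * m).factorial : ℝ)) *
    ∑ iv : Fin (2 * m + 1) → Fin p, ∑ jv : Fin (2 * m + 1) → Fin p,
      gkron (Fin.snoc iv i) (Fin.snoc jv j) *
        (A α (iv (Fin.last (2 * m))) (jv (Fin.last (2 * m))) *
          ∑ a : Fin m → Fin q, ∏ k : Fin (2 * m),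
            A (a (halfIdx k)) (iv k.castSucc) (jv k.castSucc))

/-- The (finite) set of multi-indices `u ∈ 2ℕ(q)` with `|u| = r` (all entries even,
total length `r`). -/
noncomputable def evenIdx (q r : ℕ) : Finset (Fin q → ℕ) :=
  (Fintype.piFinset fun _ : Fin q => Finset.range (r + 1)).filter
    fun u => (∀ α, Even (u α)) ∧ ∑ α, u α = r

open MvPolynomial in
/-- The matrix `tA = ∑ α, t_α A_α` with entries in the polynomial ring in `t`. -/
noncomputable def linearPencil (A : Fin q → Matrix (Fin p) (Fin p) ℝ) :
    Matrix (Fin p) (Fin p) (MvPolynomial (Fin q) ℝ) :=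
  ∑ α : Fin q, (X α : MvPolynomial (Fin q) ℝ) •
    (A α).map (fun x => (C x : MvPolynomial (Fin q) ℝ))

theorem wt_cons {s : ℕ} (a : Fin q) (c : Fin s → Fin q) :
    Finsupp.equivFunOnFinite.symm (wt (Fin.cons a c : Fin (s + 1) → Fin q)) =
      Finsupp.single a 1 + Finsupp.equivFunOnFinite.symm (wt c) := by
  ext α
  simp only [wt, Fin.card_filter_univ_succ, Finsupp.equivFunOnFinite_symm_apply_apply,
    Finsupp.add_apply, Finsupp.single_apply, Fin.cons_zero, Fin.cons_succ]
  split_ifs <;> omega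

theorem prodSeq_cons (A : Fin q → Matrix (Fin p) (Fin p) ℝ) {s : ℕ} (a : Fin q)
    (c : Fin s → Fin q) :
    prodSeq A (Fin.cons a c : Fin (s + 1) → Fin q) = A a * prodSeq A c := by
  simp [prodSeq, List.ofFn_succ]

open MvPolynomial in
theorem linearPencil_pow (A : Fin q → Matrix (Fin p) (Fin p) ℝ) (s : ℕ) :
    linearPencil A ^ s = ∑ c : Fin s → Fin q,
      monomial (Finsupp.equivFunOnFinite.symm (wt c)) (1 : ℝ) •
        (prodSeq A c).map (C : ℝ →+* MvPolynomial (Fin q) ℝ) := by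
  induction s with
  | zero =>
    have hw : Finsupp.equivFunOnFinite.symm (wt (default : Fin 0 → Fin q)) = 0 := by
      ext; simp [wt]
    rw [Fintype.sum_unique, hw]
    simp [prodSeq, Matrix.map_one _ (map_zero (C : ℝ →+* MvPolynomial (Fin q) ℝ)) (map_one _)]
  | succ s ih =>
    rw [pow_succ', ih, linearPencil, Finset.sum_mul_sum,
      ← (Fin.consEquiv fun _ : Fin (s + 1) => Fin q).sum_comp, Fintype.sum_prod_type]
    refine Finset.sum_congr rfl fun a _ => Finset.sum_congr rfl fun c _ => ?_
    change _ = monomial (Finsupp.equivFunOnFinite.symm (wt (Fin.cons a c : Fin (s + 1) → Fin q)))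
      (1 : ℝ) • (prodSeq A (Fin.cons a c : Fin (s + 1) → Fin q)).map _
    rw [wt_cons, prodSeq_cons, Matrix.map_mul, smul_mul_smul_comm, X, monomial_mul, one_mul]

open MvPolynomial in
theorem isHomogeneous_linearPencil_pow (A : Fin q → Matrix (Fin p) (Fin p) ℝ) (s : ℕ)
    (i j : Fin p) : ((linearPencil A ^ s) i j).IsHomogeneous s := by
  induction s generalizing i j with
  | zero =>
    rw [pow_zero, Matrix.one_apply]
    split_ifs
    exacts [isHomogeneous_one _ _, isHomogeneous_zero _ _ _]
  | succ s ih =>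
    rw [pow_succ, Matrix.mul_apply]
    refine IsHomogeneous.sum _ _ _ fun k _ => (ih i k).mul ?_
    rw [linearPencil, Matrix.sum_apply]
    refine IsHomogeneous.sum _ _ _ fun α _ => ?_
    exact (isHomogeneous_X ℝ α).mul (isHomogeneous_C (Fin q) (A α k j))

open MvPolynomial in
theorem coeff_mul_eq_zero_of_isHomogeneous {f g : MvPolynomial (Fin q) ℝ} {n : ℕ}
    (hg : g.IsHomogeneous n) {d : Fin q →₀ ℕ} (hd : d.degree < n) :
    coeff d (f * g) = 0 := by
  rw [coeff_mul]
  refine Finset.sum_eq_zero fun x hx => ?_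
  rw [Finset.HasAntidiagonal.mem_antidiagonal] at hx
  rw [hg.coeff_eq_zero, mul_zero]
  rw [← hx, map_add] at hd
  omega

open MvPolynomial in
theorem totalDegree_det_le {σ R : Type*} [CommRing R] {n : ℕ}
    (M : Matrix (Fin n) (Fin n) (MvPolynomial σ R))
    (hM : ∀ i j, (M i j).totalDegree ≤ 1) : M.det.totalDegree ≤ n := by
  rw [Matrix.det_apply']
  refine totalDegree_finsetSum_le fun τ _ => ?_
  refine (totalDegree_mul _ _).trans ?_
  rw [← map_intCast (C : R →+* MvPolynomial σ R), totalDegree_C, zero_add]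
  refine (totalDegree_finsetProd _ _).trans ?_
  exact (Finset.sum_le_sum fun i _ => hM (τ i) i).trans (by simp)

open MvPolynomial in
theorem totalDegree_adjugate_lt {σ R : Type*} [CommRing R] {n : ℕ}
    (M : Matrix (Fin n) (Fin n) (MvPolynomial σ R))
    (hM : ∀ i j, (M i j).totalDegree ≤ 1) (i j : Fin n) :
    (M.adjugate i j).totalDegree < n := by
  cases n with
  | zero => exact i.elim0
  | succ n =>
    rw [Matrix.adjugate_fin_succ_eq_det_submatrix, Nat.lt_succ_iff]
    refine (totalDegree_mul _ _).trans ?_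
    have hsign : ((-1 : MvPolynomial σ R) ^ (j + i : ℕ)).totalDegree = 0 := by
      rw [show (-1 : MvPolynomial σ R) = C (-1) by simp, ← map_pow, totalDegree_C]
    rw [hsign, zero_add]
    exact totalDegree_det_le _ fun _ _ => hM _ _

open MvPolynomial in
theorem totalDegree_one_add_linearPencil_le (A : Fin q → Matrix (Fin p) (Fin p) ℝ)
    (i j : Fin p) : ((1 + linearPencil A) i j).totalDegree ≤ 1 := by
  rw [Matrix.add_apply]
  refine (totalDegree_add _ _).trans (max_le ?_ ?_)
  · rw [Matrix.one_apply]
    split_ifs <;> simp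
  · simpa using (isHomogeneous_linearPencil_pow A 1 i j).totalDegree_le

open MvPolynomial in
theorem coeff_newtonMvPoly_mul_linearPencil_pow (A : Fin q → Matrix (Fin p) (Fin p) ℝ)
    (u : Fin q → ℕ) (s : ℕ) (i j : Fin p) :
    coeff (Finsupp.equivFunOnFinite.symm u) (newtonMvPoly A * (linearPencil A ^ s) i j) =
      (∑ c : Fin s → Fin q, sigmaSub A u c • prodSeq A c) i j := by
  rw [linearPencil_pow, Matrix.sum_apply, Matrix.sum_apply, Finset.mul_sum, coeff_sum]
  refine Finset.sum_congr rfl fun c _ => ?_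
  rw [Matrix.smul_apply, Matrix.smul_apply, Matrix.map_apply, smul_eq_mul, smul_eq_mul,
    ← mul_assoc, mul_comm, coeff_C_mul, coeff_mul_monomial', mul_one, mul_comm]
  congr 1
  refine if_congr Iff.rfl (congrArg (coeff · (newtonMvPoly A)) ?_) rfl
  ext α
  rfl

/-- The generating function identity `∑ T_u(A) t^u = adj (1 + tA)`, coefficientwise. -/
theorem gnt_apply_eq_coeff_adjugate (A : Fin q → Matrix (Fin p) (Fin p) ℝ)
    (u : Fin q → ℕ) (i j : Fin p) :
    gnt A u i j = MvPolynomial.coeff (Finsupp.equivFunOnFinite.symm u)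
      ((1 + linearPencil A).adjugate i j) := by
  set N := linearPencil A with hN
  set K := ∑ α, u α with hK
  have hdet : (1 + N).det = newtonMvPoly A := rfl
  have hgeom : (1 + N) * ∑ s ∈ Finset.range (K + 1), (-N) ^ s = 1 - (-N) ^ (K + 1) := by
    rw [← mul_neg_geom_sum, sub_neg_eq_add]
  have hadj : (1 + N).adjugate =
      newtonMvPoly A • ∑ s ∈ Finset.range (K + 1), (-N) ^ s +
        (1 + N).adjugate * (-N) ^ (K + 1) := by
    rw [← hdet, ← one_mul (∑ s ∈ Finset.range (K + 1), (-N) ^ s), ← smul_mul_assoc,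
      ← Matrix.adjugate_mul, mul_assoc, hgeom, mul_sub, mul_one, sub_add_cancel]
  have hneg (s : ℕ) (a b : Fin p) :
      ((-N) ^ s) a b = MvPolynomial.C ((-1 : ℝ) ^ s) * (N ^ s) a b := by
    rw [neg_pow]
    rcases Nat.even_or_odd s with hs | hs <;> simp [hs.neg_one_pow]
  have hdeg : (Finsupp.equivFunOnFinite.symm u : Fin q →₀ ℕ).degree = K := by
    simp [Finsupp.degree_eq_sum, hK]
  rw [hadj, Matrix.add_apply, MvPolynomial.coeff_add, Matrix.mul_apply,
    MvPolynomial.coeff_sum, Finset.sum_eq_zero (s := Finset.univ), add_zero]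
  · rw [Matrix.smul_apply, Matrix.sum_apply, smul_eq_mul, Finset.mul_sum,
      MvPolynomial.coeff_sum, gnt, Matrix.sum_apply]
    refine Finset.sum_congr rfl fun s _ => ?_
    rw [hneg, mul_left_comm, MvPolynomial.coeff_C_mul,
      coeff_newtonMvPoly_mul_linearPencil_pow, Matrix.smul_apply, smul_eq_mul]
  · intro k _
    rw [hneg, mul_left_comm, MvPolynomial.coeff_C_mul,
      coeff_mul_eq_zero_of_isHomogeneous (isHomogeneous_linearPencil_pow A (K + 1) k j)
        (by omega), mul_zero]

theorem statement_4 (hq : 1 ≤ q) (A : Fin q → Matrix (Fin p) (Fin p) ℝ)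
    (u : Fin q → ℕ) (h : p ≤ ∑ α, u α) :
    gnt A u = 0 := by
  ext i j
  rw [gnt_apply_eq_coeff_adjugate, Matrix.zero_apply]
  refine MvPolynomial.coeff_eq_zero_of_totalDegree_lt ?_
  refine (totalDegree_adjugate_lt _ (totalDegree_one_add_linearPencil_le A) i j).trans_le ?_
  refine h.trans_eq ?_
  rw [← Finsupp.degree_apply, Finsupp.degree_eq_sum]
  simp

end GNTPaper
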